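/- For every c ∈ ℝ and every t ∈ (K₂,K₁), one has 4·μ''(t)·μ(t)·(t−c)² + 4·(μ'(t))²·(t−c)² + 2·μ'(t)·μ(t)·(t−c) − μ(t)² = −(56/3)·t³ + 36·c·t² − 16·c²·t − (λ₁·c + λ₂); in particular the left-hand side is a nonzero cubic polynomial in t and hence has at most three zeros in (K₂,K₁). -/

import Mathlib

/-- The function `μ(t) = √(−(4/3)(t−K₁)(t−K₂)(t+K₁+K₂))`. -/
noncomputable def mu (K₁ K₂ t : ℝ) : ℝ :=
  Real.sqrt (-(4 / 3) * (t - K₁) * (t - K₂) * (t + K₁ + K₂))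

lemma radicand_pos {K₁ K₂ t : ℝ} (hK₂ : -(K₁ + K₂) ≤ K₂) (ht : t ∈ Set.Ioo K₂ K₁) :
    0 < -(4 / 3) * (t - K₁) * (t - K₂) * (t + K₁ + K₂) := by
  have h₁ : 0 < K₁ - t := sub_pos.2 ht.2
  have h₂ : 0 < t - K₂ := sub_pos.2 ht.1
  have h₃ : 0 < t + K₁ + K₂ := by linarith [ht.1]
  have h : 0 < 4 / 3 * (K₁ - t) * (t - K₂) * (t + K₁ + K₂) := by positivity
  linarith

lemma mu_pos {K₁ K₂ t : ℝ} (hK₂ : -(K₁ + K₂) ≤ K₂) (ht : t ∈ Set.Ioo K₂ K₁) :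
    0 < mu K₁ K₂ t :=
  Real.sqrt_pos.2 (radicand_pos hK₂ ht)

lemma mu_sq {K₁ K₂ t : ℝ} (hK₂ : -(K₁ + K₂) ≤ K₂) (ht : t ∈ Set.Ioo K₂ K₁) :
    mu K₁ K₂ t ^ 2 = -(4 / 3) * (t - K₁) * (t - K₂) * (t + K₁ + K₂) :=
  Real.sq_sqrt (radicand_pos hK₂ ht).le

lemma hasDerivAt_mu {K₁ K₂ t : ℝ} (hK₂ : -(K₁ + K₂) ≤ K₂) (ht : t ∈ Set.Ioo K₂ K₁) :
    HasDerivAt (mu K₁ K₂)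
      ((-4 * t ^ 2 + 4 / 3 * (K₁ ^ 2 + K₂ ^ 2 + K₁ * K₂)) / (2 * mu K₁ K₂ t)) t := by
  have h : HasDerivAt (fun s : ℝ => -(4 / 3) * (s - K₁) * (s - K₂) * (s + K₁ + K₂))
      (-4 * t ^ 2 + 4 / 3 * (K₁ ^ 2 + K₂ ^ 2 + K₁ * K₂)) t := by
    have hid := hasDerivAt_id' t
    refine ((((hid.sub_const K₁).const_mul (-(4 / 3))).fun_mul (hid.sub_const K₂)).fun_mul
      ((hid.add_const K₁).add_const K₂)).congr_deriv ?_
    ring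
  exact h.sqrt (radicand_pos hK₂ ht).ne'

lemma deriv_mu_mul_mu {K₁ K₂ t : ℝ} (hK₂ : -(K₁ + K₂) ≤ K₂) (ht : t ∈ Set.Ioo K₂ K₁) :
    2 * (deriv (mu K₁ K₂) t * mu K₁ K₂ t) =
      -4 * t ^ 2 + 4 / 3 * (K₁ ^ 2 + K₂ ^ 2 + K₁ * K₂) := by
  have hpos := mu_pos hK₂ ht
  rw [(hasDerivAt_mu hK₂ ht).deriv]
  field_simp

lemma deriv_deriv_mu_mul_mu_add {K₁ K₂ t : ℝ} (hK₂ : -(K₁ + K₂) ≤ K₂)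
    (ht : t ∈ Set.Ioo K₂ K₁) :
    deriv (deriv (mu K₁ K₂)) t * mu K₁ K₂ t + deriv (mu K₁ K₂) t ^ 2 = -4 * t := by
  have hpos := mu_pos hK₂ ht
  have heq : deriv (mu K₁ K₂) =ᶠ[nhds t] fun s =>
      (-4 * s ^ 2 + 4 / 3 * (K₁ ^ 2 + K₂ ^ 2 + K₁ * K₂)) / (2 * mu K₁ K₂ s) := by
    filter_upwards [isOpen_Ioo.mem_nhds ht] with s hs
    exact (hasDerivAt_mu hK₂ hs).deriv
  have hnum : HasDerivAt
      (fun s : ℝ => -4 * s ^ 2 + 4 / 3 * (K₁ ^ 2 + K₂ ^ 2 + K₁ * K₂)) (-8 * t) t := by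
    refine (((hasDerivAt_pow 2 t).const_mul (-4)).add_const _).congr_deriv ?_
    norm_num
    ring
  have hdiv := hnum.fun_div ((hasDerivAt_mu hK₂ ht).const_mul 2) (by positivity)
  rw [heq.deriv_eq, (hasDerivAt_mu hK₂ ht).deriv, hdiv.deriv]
  field_simp
  ring

/-- A set of zeros of a real cubic has at most three elements. -/
lemma encard_le_three_of_cubic {S : Set ℝ} {a b c d : ℝ} (ha : a ≠ 0)
    (hS : ∀ t ∈ S, a * t ^ 3 + b * t ^ 2 + c * t + d = 0) : S.encard ≤ 3 := by
  classical
  let P := (Cubic.mk a b c d).toPoly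
  have hP : P ≠ 0 := Cubic.ne_zero_of_a_ne_zero ha
  have hsub : S ⊆ (P.roots.toFinset : Set ℝ) := by
    intro t ht
    simpa [P, hP, Cubic.toPoly] using ⟨hP, hS t ht⟩
  have hcard : P.roots.toFinset.card ≤ 3 :=
    (P.roots.toFinset_card_le.trans P.card_roots').trans
      (Cubic.natDegree_of_a_ne_zero ha).le
  calc S.encard ≤ (P.roots.toFinset : Set ℝ).encard := Set.encard_le_encard hsub
    _ = P.roots.toFinset.card := Set.encard_coe_eq_coe_finsetCard _
    _ ≤ 3 := by exact_mod_cast hcard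

/-- On `(K₂,K₁)` one has
`4μ''μ(t−c)² + 4(μ')²(t−c)² + 2μ'μ(t−c) − μ² = −(56/3)t³ + 36ct² − 16c²t − (λ₁c + λ₂)`,
where `λ₁ = (4/3)(K₁² + K₂² + K₁K₂)` and `λ₂ = −(4/3)K₁K₂(K₁+K₂)`; in particular the
left-hand side has at most three zeros in `(K₂,K₁)`. -/
theorem expression_is_cubic
    (K₁ K₂ : ℝ) (hK₁ : 0 < K₁) (hK₁₂ : K₂ < K₁) (hK₂ : -(K₁ + K₂) ≤ K₂)
    (c : ℝ) (lam₁ lam₂ : ℝ)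
    (hlam₁ : lam₁ = (4 / 3) * (K₁ ^ 2 + K₂ ^ 2 + K₁ * K₂))
    (hlam₂ : lam₂ = -(4 / 3) * K₁ * K₂ * (K₁ + K₂)) :
    (∀ t ∈ Set.Ioo K₂ K₁,
      4 * deriv (deriv (mu K₁ K₂)) t * mu K₁ K₂ t * (t - c) ^ 2 +
        4 * (deriv (mu K₁ K₂) t) ^ 2 * (t - c) ^ 2 +
        2 * deriv (mu K₁ K₂) t * mu K₁ K₂ t * (t - c) - (mu K₁ K₂ t) ^ 2 =
      -(56 / 3) * t ^ 3 + 36 * c * t ^ 2 - 16 * c ^ 2 * t - (lam₁ * c + lam₂)) ∧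
    {t ∈ Set.Ioo K₂ K₁ |
      4 * deriv (deriv (mu K₁ K₂)) t * mu K₁ K₂ t * (t - c) ^ 2 +
        4 * (deriv (mu K₁ K₂) t) ^ 2 * (t - c) ^ 2 +
        2 * deriv (mu K₁ K₂) t * mu K₁ K₂ t * (t - c) - (mu K₁ K₂ t) ^ 2 = 0}.encard
      ≤ 3 := by
  have key : ∀ t ∈ Set.Ioo K₂ K₁,
      4 * deriv (deriv (mu K₁ K₂)) t * mu K₁ K₂ t * (t - c) ^ 2 +
        4 * (deriv (mu K₁ K₂) t) ^ 2 * (t - c) ^ 2 +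
        2 * deriv (mu K₁ K₂) t * mu K₁ K₂ t * (t - c) - (mu K₁ K₂ t) ^ 2 =
      -(56 / 3) * t ^ 3 + 36 * c * t ^ 2 - 16 * c ^ 2 * t - (lam₁ * c + lam₂) := by
    intro t ht
    subst hlam₁ hlam₂
    linear_combination 4 * (t - c) ^ 2 * deriv_deriv_mu_mul_mu_add hK₂ ht +
      (t - c) * deriv_mu_mul_mu hK₂ ht - mu_sq hK₂ ht
  refine ⟨key, encard_le_three_of_cubic (a := -(56 / 3)) (b := 36 * c)
    (c := -16 * c ^ 2) (d := -(lam₁ * c + lam₂)) (by norm_num) ?_⟩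
  rintro t ⟨ht, hzero⟩
  rw [key t ht] at hzero
  linear_combination hzero
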